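/- arXiv:2105.11379 — 3 statements merged into one kernel-verified Lean document; each statement's English description precedes it below -/
import Mathlib

section
/- Assume condition (C2) holds (for some constants c* > 0 and b > c* and sets M_c as in (C2)). Let c ∈ [c*, b), set B = K_c ∪ M_c ∪ (−M_c), and let δ > 0. Then there exists ε₀ > 0 such that for each ε ∈ (0, ε₀) there is a continuous map η : W × [0,1] → W satisfying: (i) η(·,0) is the identity of W; (ii) for each t ∈ [0,1], η(·,t) is an odd homeomorphism of W (i.e., a bijection of W that is continuous with continuous inverse and satisfies η(−u,t) = −η(u,t)); (iii) for each t ∈ [0,1], η(u,t) = u whenever E(u) < c − 2ε, or E(u) > c + 2ε, or dist(u, B) ≤ δ/3; (iv) ‖η(u,t) − u‖ ≤ δ/4 for all (u,t) ∈ W × [0,1]; (v) for each u ∈ W, the function t ↦ E(η(u,t)) is nonincreasing on [0,1]; (vi) for every u ∈ W with E(u) ≤ c + ε and dist(u, B) > δ, one has E(η(u,1)) ≤ c − ε. -/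
open Metric Set Filter Topology
open scoped NNReal

section Flow

variable {X : Type*} [NormedAddCommGroup X] [NormedSpace ℝ X] {v : X → X} {C : ℝ≥0}

/-- Uniqueness of integral curves of a locally Lipschitz vector field on an open interval. -/
theorem LocallyLipschitz.eqOn_Ioo_of_hasDerivAt (hv : LocallyLipschitz v) {f g : ℝ → X}
    {a b t₀ : ℝ} (ht₀ : t₀ ∈ Ioo a b)
    (hf : ∀ t ∈ Ioo a b, HasDerivAt f (v (f t)) t) (hg : ∀ t ∈ Ioo a b, HasDerivAt g (v (g t)) t)
    (heq : f t₀ = g t₀) : EqOn f g (Ioo a b) := by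
  intro t ht
  obtain ⟨a', ha, ha'⟩ := exists_between (lt_min ht₀.1 ht.1)
  obtain ⟨b', hb', hb⟩ := exists_between (max_lt ht₀.2 ht.2)
  rw [lt_min_iff] at ha'
  rw [max_lt_iff] at hb'
  have hsub : Icc a' b' ⊆ Ioo a b := Icc_subset_Ioo ha hb
  have hfc : ContinuousOn f (Icc a' b') := HasDerivAt.continuousOn fun s hs => hf s (hsub hs)
  have hgc : ContinuousOn g (Icc a' b') := HasDerivAt.continuousOn fun s hs => hg s (hsub hs)
  obtain ⟨K, hK⟩ := LocallyLipschitzOn.exists_lipschitzOnWith_of_compact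
    ((isCompact_Icc.image_of_continuousOn hfc).union (isCompact_Icc.image_of_continuousOn hgc))
    hv.locallyLipschitzOn
  have hIcc : Ioo a' b' ⊆ Icc a' b' := Ioo_subset_Icc_self
  exact ODE_solution_unique_of_mem_Icc (v := fun _ => v) (fun _ _ => hK) ⟨ha'.1, hb'.1⟩ hfc
    (fun s hs => hf s (hsub (hIcc hs))) (fun s hs => .inl (mem_image_of_mem f (hIcc hs))) hgc
    (fun s hs => hg s (hsub (hIcc hs))) (fun s hs => .inr (mem_image_of_mem g (hIcc hs))) heq
    ⟨ha'.2.le, hb'.2.le⟩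

/-- Uniqueness of global integral curves of a locally Lipschitz vector field. -/
theorem LocallyLipschitz.eq_of_hasDerivAt (hv : LocallyLipschitz v) {f g : ℝ → X}
    (hf : ∀ t, HasDerivAt f (v (f t)) t) (hg : ∀ t, HasDerivAt g (v (g t)) t)
    (heq : f 0 = g 0) : f = g := by
  ext t
  exact hv.eqOn_Ioo_of_hasDerivAt (a := -(|t| + 1)) (b := |t| + 1)
    ⟨by linarith [abs_nonneg t], by linarith [abs_nonneg t]⟩ (fun s _ => hf s) (fun s _ => hg s)
    heq ⟨by linarith [neg_abs_le t], by linarith [le_abs_self t]⟩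

/-- A bounded locally Lipschitz vector field has a continuous local flow near every point. -/
theorem LocallyLipschitz.exists_local_flow [CompleteSpace X] (hv : LocallyLipschitz v)
    (hC : ∀ x, ‖v x‖ ≤ C) (x : X) :
    ∃ r > 0, ∃ ε > 0, ∃ α : X × ℝ → X,
      (∀ y ∈ closedBall x r, α (y, 0) = y ∧
        ∀ t ∈ Ioo (-ε) ε, HasDerivAt (fun s => α (y, s)) (v (α (y, t))) t) ∧
      ContinuousOn α (closedBall x r ×ˢ Ioo (-ε) ε) := by
  obtain ⟨K, s, hs, hl⟩ := hv x
  obtain ⟨a, ha, has⟩ := nhds_basis_closedBall.mem_iff.1 hs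
  lift a to ℝ≥0 using ha.le
  set ε : ℝ := (a / 2) / (C + 1) with hε
  have hε0 : 0 < ε := by positivity
  have hpl : IsPicardLindelof (fun _ => v) (tmin := -ε) (tmax := ε)
      ⟨0, by linarith, by linarith⟩ x a (a / 2) C K := by
    refine .of_time_independent (fun y _ => hC y) (hl.mono has) ?_
    have h1 : (C : ℝ) * ε ≤ a / 2 := by
      rw [hε, mul_div_assoc', div_le_iff₀ (by positivity)]
      nlinarith [C.coe_nonneg, a.coe_nonneg]
    simp only [sub_zero, zero_sub, neg_neg, max_self, NNReal.coe_div, NNReal.coe_ofNat]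
    linarith
  obtain ⟨α, hα, hcont⟩ := hpl.exists_forall_mem_closedBall_eq_hasDerivWithinAt_continuousOn
  refine ⟨a / 2, by positivity, ε, hε0, α, fun y hy => ?_, ?_⟩
  · have := hα y (by simpa using hy)
    exact ⟨this.1, fun t ht => (this.2 t (Ioo_subset_Icc_self ht)).hasDerivAt
      (Icc_mem_nhds ht.1 ht.2)⟩
  · refine hcont.mono (prod_mono ?_ Ioo_subset_Icc_self)
    simp

/-- Two integral curves meeting at time `t₀` can be concatenated there. -/
theorem hasDerivAt_concat {f g : ℝ → X} {t₀ t : ℝ}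
    (hf : t ≤ t₀ → HasDerivAt f (v (f t)) t) (hg : t₀ ≤ t → HasDerivAt g (v (g t)) t)
    (heq : f t₀ = g t₀) :
    HasDerivAt (fun s => if s ≤ t₀ then f s else g s) (v (if t ≤ t₀ then f t else g t)) t := by
  rcases lt_trichotomy t t₀ with h | rfl | h
  · rw [if_pos h.le]
    refine (hf h.le).congr_of_eventuallyEq ?_
    filter_upwards [Iio_mem_nhds h] with s hs
    rw [if_pos (le_of_lt hs)]
  · rw [if_pos le_rfl, ← hasDerivWithinAt_univ, ← Iic_union_Ici (a := t)]
    refine ((hf le_rfl).hasDerivWithinAt.congr_of_mem (fun s hs => if_pos hs) self_mem_Iic).union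
      ((heq ▸ (hg le_rfl).hasDerivWithinAt).congr_of_mem (fun s hs => ?_) self_mem_Ici)
    rcases (mem_Ici.1 hs).eq_or_lt with rfl | h
    · simp [heq]
    · exact if_neg h.not_ge
  · rw [if_neg h.not_ge]
    refine (hg h.le).congr_of_eventuallyEq ?_
    filter_upwards [Ioi_mem_nhds h] with s hs
    rw [if_neg (not_le_of_gt hs)]

/-- Integral curves with a common value at `0`, defined on the intervals `(a, T)` for `T ∈ A`,
glue to an integral curve on the union of these intervals. -/
theorem LocallyLipschitz.exists_glue (hv : LocallyLipschitz v) {x : X} {a : ℝ} (ha : a < 0)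
    {A : Set ℝ} (hA : ∀ T ∈ A, 0 < T) (h : ∀ T ∈ A, ∃ α : ℝ → X, α 0 = x ∧
      ∀ t ∈ Ioo a T, HasDerivAt α (v (α t)) t) (hne : A.Nonempty) :
    ∃ α : ℝ → X, α 0 = x ∧ ∀ T ∈ A, ∀ t ∈ Ioo a T, HasDerivAt α (v (α t)) t := by
  classical
  choose! β hβ0 hβ using h
  obtain ⟨T₀, hT₀⟩ := hne
  let τ : ℝ → ℝ := fun t => if ht : ∃ T ∈ A, t < T then ht.choose else T₀
  have hτ : ∀ t T, T ∈ A → t < T → τ t ∈ A ∧ t < τ t := fun t T hT htT => by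
    have ht : ∃ T ∈ A, t < T := ⟨T, hT, htT⟩
    simp only [τ, dif_pos ht]
    exact ht.choose_spec
  have key : ∀ T ∈ A, ∀ t ∈ Ioo a T, β (τ t) t = β T t := fun T hT t ht => by
    obtain ⟨h1, h2⟩ := hτ t T hT ht.2
    exact hv.eqOn_Ioo_of_hasDerivAt (a := a) (b := min (τ t) T)
      ⟨ha, lt_min (hA _ h1) (hA _ hT)⟩
      (fun s hs => hβ _ h1 s ⟨hs.1, hs.2.trans_le (min_le_left _ _)⟩)
      (fun s hs => hβ _ hT s ⟨hs.1, hs.2.trans_le (min_le_right _ _)⟩)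
      ((hβ0 _ h1).trans (hβ0 _ hT).symm) ⟨ht.1, lt_min h2 ht.2⟩
  refine ⟨fun t => β (τ t) t, ?_, fun T hT t ht => ?_⟩
  · exact hβ0 _ (hτ 0 T₀ hT₀ (hA _ hT₀)).1
  · simp only [key T hT t ht]
    refine (hβ T hT t ht).congr_of_eventuallyEq ?_
    filter_upwards [Ioo_mem_nhds ht.1 ht.2] with s hs using key T hT s hs

/-- An integral curve of a bounded locally Lipschitz vector field on a bounded interval can be
extended to the right. -/
theorem LocallyLipschitz.exists_extension [CompleteSpace X] (hv : LocallyLipschitz v)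
    (hC : ∀ x, ‖v x‖ ≤ C) {α : ℝ → X} {a b : ℝ} (hab : a < b)
    (hα : ∀ t ∈ Ioo a b, HasDerivAt α (v (α t)) t) {s : ℝ} (hs : s ∈ Ioo a b) :
    ∃ b' > b, ∃ β : ℝ → X, β s = α s ∧ ∀ t ∈ Ioo a b', HasDerivAt β (v (β t)) t := by
  have hlip : LipschitzOnWith C α (Ioo a b) :=
    (convex_Ioo a b).lipschitzOnWith_of_nnnorm_hasDerivWithin_le
      (fun t ht => (hα t ht).hasDerivWithinAt) (fun t _ => hC _)
  have hcau : Cauchy (map α (𝓝[Ioo a b] b)) := by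
    have : (𝓝[Ioo a b] b).NeBot := right_nhdsWithin_Ioo_neBot hab
    exact (cauchy_nhds.mono nhdsWithin_le_nhds).map_of_le hlip.uniformContinuousOn inf_le_right
  obtain ⟨y, hy⟩ := CompleteSpace.complete hcau
  obtain ⟨r, hr, ε, hε, φ, hφ, -⟩ := hv.exists_local_flow hC y
  have hmem : ∀ᶠ t in 𝓝[<] b, α t ∈ closedBall y r ∧ t ∈ Ioo (max s (b - ε)) b := by
    rw [nhdsWithin_Ioo_eq_nhdsLT hab] at hy
    exact (eventually_map.1 (hy (closedBall_mem_nhds y hr))).and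
      (Ioo_mem_nhdsLT (max_lt hs.2 (by linarith)))
  obtain ⟨t₁, ht₁, ht₁', ht₁b⟩ := hmem.exists
  rw [max_lt_iff] at ht₁'
  obtain ⟨hφ0, hφd⟩ := hφ _ ht₁
  refine ⟨t₁ + ε, by linarith, fun t => if t ≤ t₁ then α t else φ (α t₁, t - t₁), ?_,
    fun t ht => hasDerivAt_concat (fun h => hα t ⟨ht.1, h.trans_lt ht₁b⟩) (fun h => ?_) ?_⟩
  · exact if_pos ht₁'.1.le
  · exact (hφd (t - t₁) ⟨by linarith, by linarith [ht.2]⟩).comp_sub_const t t₁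
  · simp [hφ0]

/-- Every point is the origin of a forward integral curve of a bounded locally Lipschitz vector
field, defined for all nonnegative times. -/
theorem LocallyLipschitz.exists_forward_integralCurve [CompleteSpace X] (hv : LocallyLipschitz v)
    (hC : ∀ x, ‖v x‖ ≤ C) (x : X) :
    ∃ α : ℝ → X, α 0 = x ∧ ∀ t, 0 ≤ t → HasDerivAt α (v (α t)) t := by
  obtain ⟨r, hr, ε, hε, φ, hφ, -⟩ := hv.exists_local_flow hC x
  obtain ⟨hφ0, hφd⟩ := hφ x (mem_closedBall_self hr.le)
  let S : Set ℝ := {T | 0 < T ∧ ∃ α : ℝ → X, α 0 = x ∧ ∀ t ∈ Ioo (-ε) T, HasDerivAt α (v (α t)) t}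
  have hεS : ε ∈ S := ⟨hε, _, hφ0, hφd⟩
  obtain ⟨α, hα0, hα⟩ := hv.exists_glue (neg_lt_zero.2 hε) (fun T hT => hT.1)
    (fun T (hT : T ∈ S) => hT.2) ⟨ε, hεS⟩
  have hunb : ¬ BddAbove S := fun hbdd => by
    have hsup : ε ≤ sSup S := le_csSup hbdd hεS
    obtain ⟨b', hb', β, hβ0, hβ⟩ := hv.exists_extension hC (a := -ε) (b := sSup S) (s := 0)
      (by linarith) (fun t ht => by
        obtain ⟨T, hT, htT⟩ := exists_lt_of_lt_csSup ⟨ε, hεS⟩ ht.2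
        exact hα T hT t ⟨ht.1, htT⟩) ⟨by linarith, by linarith⟩
    exact (le_csSup hbdd (show b' ∈ S from ⟨by linarith, β, hβ0.trans hα0, hβ⟩)).not_gt hb'
  refine ⟨α, hα0, fun t ht => ?_⟩
  obtain ⟨T, hT, htT⟩ := not_bddAbove_iff.1 hunb t
  exact hα T hT t ⟨by linarith, htT⟩

/-- Bounded locally Lipschitz vector fields are complete. -/
theorem LocallyLipschitz.exists_integralCurve [CompleteSpace X] (hv : LocallyLipschitz v)
    (hC : ∀ x, ‖v x‖ ≤ C) (x : X) :
    ∃ α : ℝ → X, α 0 = x ∧ ∀ t, HasDerivAt α (v (α t)) t := by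
  obtain ⟨α, hα0, hα⟩ := hv.exists_forward_integralCurve hC x
  obtain ⟨β, hβ0, hβ⟩ := LocallyLipschitz.exists_forward_integralCurve (v := fun y => -v y)
    hv.neg (C := C) (by simpa using hC) x
  refine ⟨fun t => if t ≤ 0 then β (-t) else α t, by simp [hβ0], fun t =>
    hasDerivAt_concat (f := fun t => β (-t)) (fun h => ?_) (hα t) (by simp [hα0, hβ0])⟩
  simpa [Function.comp_def] using (hβ (-t) (by linarith)).scomp t (hasDerivAt_neg t)

/-- The flow of a bounded locally Lipschitz vector field on a Banach space is global and jointly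
continuous. -/
theorem LocallyLipschitz.exists_global_flow [CompleteSpace X] (hv : LocallyLipschitz v)
    (hC : ∀ x, ‖v x‖ ≤ C) :
    ∃ φ : X → ℝ → X, (∀ x, φ x 0 = x) ∧ (∀ x t, HasDerivAt (φ x) (v (φ x t)) t) ∧
      (∀ x s t, φ (φ x s) t = φ x (s + t)) ∧ Continuous (fun q : X × ℝ => φ q.1 q.2) := by
  choose φ hφ0 hφ using hv.exists_integralCurve hC
  have hadd : ∀ x s t, φ (φ x s) t = φ x (s + t) := fun x s =>
    congrFun <| hv.eq_of_hasDerivAt (hφ _)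
      (fun t => (hφ x (s + t)).comp_const_add s t) (by simp [hφ0])
  refine ⟨φ, hφ0, hφ, hadd, continuous_iff_continuousAt.2 fun ⟨x, t⟩ => ?_⟩
  let P : ℝ → ℝ → Prop := fun s t =>
    ContinuousAt (fun q : X × ℝ => φ q.1 q.2) (x, s) →
      ContinuousAt (fun q : X × ℝ => φ q.1 q.2) (x, t)
  have hlocal : ∀ y, ∃ r > 0, ∃ ε > 0,
      ContinuousOn (fun q : X × ℝ => φ q.1 q.2) (ball y r ×ˢ Ioo (-ε) ε) := fun y => by
    obtain ⟨r, hr, ε, hε, α, hα, hcont⟩ := hv.exists_local_flow hC y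
    refine ⟨r, hr, ε, hε, (hcont.mono (prod_mono_left ball_subset_closedBall)).congr ?_⟩
    rintro ⟨z, t⟩ ⟨hz, ht⟩
    obtain ⟨h0, hd⟩ := hα z (ball_subset_closedBall hz)
    exact hv.eqOn_Ioo_of_hasDerivAt ⟨neg_lt_zero.2 hε, hε⟩ (fun t _ => hφ z t) hd
      ((hφ0 z).trans h0.symm) ht
  have hP : ∀ τ, ∀ᶠ s in 𝓝 τ, ∀ᶠ t in 𝓝 τ, P s t ∧ P t s := fun τ => by
    obtain ⟨r, hr, ε, hε, hcont⟩ := hlocal (φ x τ)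
    have hN : ∀ᶠ s in 𝓝 τ, φ x s ∈ ball (φ x τ) r ∧ s ∈ Ioo (τ - ε / 2) (τ + ε / 2) :=
      ((hφ x τ).continuousAt.eventually (ball_mem_nhds _ hr)).and
        (Ioo_mem_nhds (by linarith) (by linarith))
    have key : ∀ s t, φ x s ∈ ball (φ x τ) r ∧ s ∈ Ioo (τ - ε / 2) (τ + ε / 2) →
        t ∈ Ioo (τ - ε / 2) (τ + ε / 2) → P s t := fun s t hs ht hcs => by
      have h1 : ContinuousAt (fun q : X × ℝ => (φ q.1 s, q.2 - s)) (x, t) := by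
        refine ContinuousAt.prodMk ?_ (by fun_prop)
        exact ContinuousAt.comp (f := fun q : X × ℝ => (q.1, s)) (x := (x, t)) hcs (by fun_prop)
      have h2 : ContinuousAt (fun q : X × ℝ => φ q.1 q.2) (φ x s, t - s) :=
        hcont.continuousAt (prod_mem_nhds (isOpen_ball.mem_nhds hs.1)
          (Ioo_mem_nhds (by linarith [hs.2.2, ht.1]) (by linarith [hs.2.1, ht.2])))
      have h3 := ContinuousAt.comp (f := fun q : X × ℝ => (φ q.1 s, q.2 - s)) (x := (x, t)) h2 h1
      simpa [Function.comp_def, hadd] using h3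
    filter_upwards [hN] with s hs
    filter_upwards [hN] with t ht
    exact ⟨key s t hs ht.2, key t s ht hs.2⟩
  refine PreconnectedSpace.induction₂' P (fun τ => ?_) ⟨fun _ _ _ h h' => h' ∘ h⟩ 0 t ?_
  · exact (hP τ).self_of_nhds
  · obtain ⟨r, hr, ε, hε, hcont⟩ := hlocal x
    exact hcont.continuousAt (prod_mem_nhds (ball_mem_nhds x hr) (Ioo_mem_nhds (by linarith) hε))

end Flow

section Selection

variable {X : Type*} [MetricSpace X] {F : Type*} [NormedAddCommGroup F] [NormedSpace ℝ F]

/-- Locally Lipschitz weights give a locally Lipschitz barycenter. -/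
theorem exists_lipschitzOnWith_centerMass {ι : Type*} (I : Finset ι) {ψ : ι → X → ℝ}
    (hψ : ∀ i, LipschitzWith 1 (ψ i)) (z : ι → F) {x : X} (hx : ∑ i ∈ I, ψ i x ≠ 0) :
    ∃ K, ∃ s ∈ 𝓝 x, LipschitzOnWith K (fun y => I.centerMass (ψ · y) z) s := by
  let G : (I → ℝ) → F := fun p => (∑ i, p i)⁻¹ • ∑ i, p i • z i
  let Ψ : X → I → ℝ := fun y i => ψ i y
  have hΨ : LipschitzWith 1 Ψ := LipschitzWith.of_dist_le_mul fun y y' =>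
    (dist_pi_le_iff (by positivity)).2 fun i => (hψ i).dist_le_mul y y'
  have hG : ContDiffAt ℝ 1 G (Ψ x) := by
    refine ContDiffAt.smul (ContDiffAt.inv (by fun_prop) ?_) (by fun_prop)
    rw [← Finset.sum_coe_sort I (fun i => ψ i x)] at hx
    exact hx
  obtain ⟨K, t, ht, hK⟩ := hG.exists_lipschitzOnWith
  refine ⟨K * 1, Ψ ⁻¹' t, hΨ.continuous.continuousAt.preimage_mem_nhds ht, ?_⟩
  have hcomp : (fun y => I.centerMass (ψ · y) z) = G ∘ Ψ := by
    ext y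
    simp only [Finset.centerMass, G, Ψ, Function.comp_apply,
      Finset.sum_coe_sort I (fun i => ψ i y), Finset.sum_coe_sort I (fun i => ψ i y • z i)]
  rw [hcomp]
  exact hK.comp hΨ.lipschitzOnWith (mapsTo_preimage _ _)

/-- A convex-valued map that locally has constant selections has a locally Lipschitz selection. -/
theorem exists_locallyLipschitz_forall_mem_convex_of_local_const {t : X → Set F}
    (ht : ∀ x, Convex ℝ (t x)) (H : ∀ x, ∃ z, ∀ᶠ y in 𝓝 x, z ∈ t y) :
    ∃ g : X → F, LocallyLipschitz g ∧ ∀ x, g x ∈ t x := by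
  classical
  choose z hz using H
  obtain ⟨U, hUo, hUcov, hUf, hUt⟩ := precise_refinement (fun x => interior {y | z x ∈ t y})
    (fun _ => isOpen_interior)
    (eq_univ_of_forall fun x => mem_iUnion.2 ⟨x, mem_interior_iff_mem_nhds.2 (hz x)⟩)
  replace hUt : ∀ i, ∀ y ∈ U i, z i ∈ t y := fun i y hy =>
    show y ∈ {y | z i ∈ t y} from interior_subset (hUt i hy)
  by_cases huniv : ∃ i, U i = univ
  · obtain ⟨i, hi⟩ := huniv
    exact ⟨fun _ => z i, LocallyLipschitz.const _, fun x => hUt i x (hi ▸ mem_univ x)⟩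
  push Not at huniv
  let ψ : X → X → ℝ := fun i y => infDist y (U i)ᶜ
  have hψ0 : ∀ i y, y ∉ U i → ψ i y = 0 := fun i y hy => infDist_zero_of_mem hy
  have hψpos : ∀ i, ∀ y ∈ U i, 0 < ψ i y := fun i y hy =>
    ((hUo i).isClosed_compl.notMem_iff_infDist_pos (nonempty_compl.2 (huniv i))).1 (not_not.2 hy)
  let T : X → Finset X := fun y => (hUf.point_finite y).toFinset
  have hT : ∀ {i y}, i ∈ T y ↔ y ∈ U i := fun {i y} => Finite.mem_toFinset _
  have hpos : ∀ y, 0 < ∑ i ∈ T y, ψ i y := fun y => by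
    obtain ⟨i, hi⟩ := mem_iUnion.1 (hUcov ▸ mem_univ y)
    exact Finset.sum_pos (fun j hj => hψpos j y (hT.1 hj)) ⟨i, hT.2 hi⟩
  refine ⟨fun y => (T y).centerMass (ψ · y) z, fun x => ?_, fun x =>
    (ht x).centerMass_mem (fun i _ => infDist_nonneg) (hpos x) fun i hi => hUt i x (hT.1 hi)⟩
  obtain ⟨N, hN, hfin⟩ := hUf x
  have hsub : ∀ y ∈ N, T y ⊆ hfin.toFinset := fun y hy i hi =>
    hfin.mem_toFinset.2 ⟨y, hT.1 hi, hy⟩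
  have hzero : ∀ y, ∀ i ∈ hfin.toFinset, i ∉ T y → ψ i y = 0 := fun y i _ hi =>
    hψ0 i y (mt hT.2 hi)
  obtain ⟨K, s, hs, hK⟩ := exists_lipschitzOnWith_centerMass hfin.toFinset (ψ := ψ)
    (fun i => lipschitz_infDist_pt _) z (x := x)
    (by rw [← Finset.sum_subset (hsub x (mem_of_mem_nhds hN)) (hzero x)]; exact (hpos x).ne')
  have heq : ∀ y ∈ N, (T y).centerMass (ψ · y) z = hfin.toFinset.centerMass (ψ · y) z :=
    fun y hy => Finset.centerMass_subset z (hsub y hy) (hzero y)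
  refine ⟨K, s ∩ N, inter_mem hs hN, fun y hy y' hy' => ?_⟩
  simpa only [heq y hy.2, heq y' hy'.2] using hK hy.1 hy'.1

end Selection

section Deformation

variable {X : Type*} [NormedAddCommGroup X] [NormedSpace ℝ X]
  {E : X → ℝ} {E' : X → X →L[ℝ] ℝ} {d : X → ℝ} {c δ ρ ε : ℝ}

theorem fderiv_neg_eq_neg_of_even (hE : ∀ u, HasFDerivAt E (E' u) u) (heven : ∀ u, E (-u) = E u)
    (u : X) : E' (-u) = -E' u := by
  have h : HasFDerivAt E ((E' (-u)).comp (-ContinuousLinearMap.id ℝ X)) u := by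
    have := (hE (-u)).comp u (hasFDerivAt_id u).neg
    rwa [show E ∘ Neg.neg = E from funext heven] at this
  ext w
  have := DFunLike.congr_fun (h.unique (hE u)) w
  simp only [ContinuousLinearMap.comp_apply, neg_apply,
    ContinuousLinearMap.id_apply, map_neg] at this
  simp [← this]

/-- An odd locally Lipschitz pseudo-gradient field of an even functional, vanishing away from
the level `c` and near the set `{d = 0}`. -/
theorem exists_odd_pseudoGradient (hE : ∀ u, HasFDerivAt E (E' u) u) (hE' : Continuous E')
    (heven : ∀ u, E (-u) = E u) (hd : Continuous d) (hdeven : ∀ u, d (-u) = d u)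
    (hδ : 0 < δ) (hρ : 0 < ρ) (hε : ε ∈ Ioc 0 ρ)
    (hbound : ∀ u, |E u - c| ≤ ρ → 3 * δ / 4 ≤ d u → ρ ≤ ‖E' u‖) :
    ∃ V : X → X, LocallyLipschitz V ∧ (∀ u, V (-u) = -V u) ∧ (∀ u, ‖V u‖ ≤ δ / 4) ∧
      (∀ u, E' u (V u) ≤ 0) ∧
      (∀ u, |E u - c| ≤ ε → 3 * δ / 4 ≤ d u → E' u (V u) ≤ -(δ * ρ / 8)) ∧
      (∀ u, (2 * ε ≤ |E u - c| ∨ d u ≤ δ / 3) → V u = 0) := by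
  have hEc : Continuous E := continuous_iff_continuousAt.2 fun u => (hE u).continuousAt
  let t : X → Set X := fun u => {w | ‖w‖ ≤ δ / 4 ∧ E' u w ≤ 0 ∧
    (|E u - c| ≤ ε → 3 * δ / 4 ≤ d u → E' u w ≤ -(δ * ρ / 8)) ∧
    ((2 * ε ≤ |E u - c| ∨ d u ≤ δ / 3) → w = 0)}
  have ht : ∀ u, Convex ℝ (t u) := fun u w₁ h₁ w₂ h₂ a b ha hb hab => by
    refine ⟨?_, ?_, fun h h' => ?_, fun h => ?_⟩
    · have := (convex_closedBall (0 : X) (δ / 4)) (by simpa using h₁.1) (by simpa using h₂.1)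
        ha hb hab
      simpa using this
    · simp only [map_add, map_smul, smul_eq_mul]
      nlinarith [mul_nonneg ha (neg_nonneg.2 h₁.2.1), mul_nonneg hb (neg_nonneg.2 h₂.2.1)]
    · simp only [map_add, map_smul, smul_eq_mul]
      calc a * E' u w₁ + b * E' u w₂ ≤ a * -(δ * ρ / 8) + b * -(δ * ρ / 8) := by
            gcongr
            exacts [h₁.2.2.1 h h', h₂.2.2.1 h h']
        _ = -(δ * ρ / 8) := by rw [← add_mul, hab, one_mul]
    · rw [h₁.2.2.2 h, h₂.2.2.2 h, smul_zero, smul_zero, add_zero]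
  have hloc : ∀ u, ∃ w, ∀ᶠ y in 𝓝 u, w ∈ t y := fun u => by
    by_cases hu : |E u - c| ≤ ε ∧ 3 * δ / 4 ≤ d u
    · obtain ⟨w, hw1, hw⟩ := (E' u).exists_lt_apply_of_lt_opNorm
        ((half_lt_self hρ).trans_le (hbound u (hu.1.trans hε.2) hu.2))
      obtain ⟨w', hw'1, hw'⟩ : ∃ w', ‖w'‖ < 1 ∧ ρ / 2 < -E' u w' := by
        rcases lt_abs.1 (Real.norm_eq_abs (E' u w) ▸ hw) with h | h
        · exact ⟨-w, by simpa using hw1, by simpa using h⟩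
        · exact ⟨w, hw1, h⟩
      refine ⟨(δ / 4) • w', ?_⟩
      have h1 : ∀ᶠ y in 𝓝 u, E' y ((δ / 4) • w') < -(δ * ρ / 8) := by
        refine (hE'.clm_apply continuous_const).continuousAt.eventually_lt continuousAt_const ?_
        rw [map_smul, smul_eq_mul]
        nlinarith [mul_pos hδ (sub_pos.2 hw')]
      have h2 : ∀ᶠ y in 𝓝 u, |E y - c| < 2 * ε :=
        (hEc.sub continuous_const).abs.continuousAt.eventually_lt continuousAt_const
          (show |E u - c| < 2 * ε by linarith [hu.1, hε.1])
      have h3 : ∀ᶠ y in 𝓝 u, δ / 3 < d y :=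
        continuousAt_const.eventually_lt hd.continuousAt (by linarith [hu.2])
      filter_upwards [h1, h2, h3] with y hy1 hy2 hy3
      refine ⟨?_, ?_, fun _ _ => hy1.le, fun h => ?_⟩
      · rw [norm_smul, Real.norm_of_nonneg (by positivity)]
        exact mul_le_of_le_one_right (by positivity) hw'1.le
      · linarith [mul_pos hδ hρ]
      · rcases h with h | h <;> linarith
    · refine ⟨0, ?_⟩
      have hclosed : IsClosed {u | |E u - c| ≤ ε ∧ 3 * δ / 4 ≤ d u} :=
        (isClosed_le (hEc.sub continuous_const).abs continuous_const).inter
          (isClosed_le continuous_const hd)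
      filter_upwards [hclosed.isOpen_compl.mem_nhds hu] with y hy
      exact ⟨by simp; positivity, by simp, fun h h' => absurd ⟨h, h'⟩ hy, fun _ => rfl⟩
  obtain ⟨g, hg, hgt⟩ := exists_locallyLipschitz_forall_mem_convex_of_local_const ht hloc
  have hneg : ∀ u, -g (-u) ∈ t u := fun u => by
    obtain ⟨h1, h2, h3, h4⟩ := hgt (-u)
    simp only [heven, hdeven, fderiv_neg_eq_neg_of_even hE heven, neg_apply]
      at h2 h3 h4
    exact ⟨by rwa [norm_neg], by rwa [map_neg], by simpa only [map_neg] using h3,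
      fun h => neg_eq_zero.2 (h4 h)⟩
  let V : X → X := fun u => (1 / 2 : ℝ) • (g u + -g (-u))
  have hV : ∀ u, V u ∈ t u := fun u => by
    simpa only [V, smul_add] using
      ht u (hgt u) (hneg u) (by norm_num) (by norm_num) (add_halves (1 : ℝ))
  refine ⟨V, ?_, fun u => ?_, fun u => (hV u).1, fun u => (hV u).2.1, fun u => (hV u).2.2.1,
    fun u => (hV u).2.2.2⟩
  · exact (lipschitzWith_smul (1 / 2 : ℝ)).locallyLipschitz.comp
      (hg.add (hg.comp LipschitzWith.id.neg.locallyLipschitz).neg)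
  · simp only [V, neg_neg, ← smul_neg, neg_add]
    rw [add_comm]

/-- If `‖E'‖` is bounded below near the level `c` away from the set `{d = 0}`, then the flow of a
pseudo-gradient field pushes sublevel sets of `E` below the level `c` away from that set. -/
theorem exists_deformation_of_norm_fderiv_ge [CompleteSpace X] (hE : ∀ u, HasFDerivAt E (E' u) u)
    (hE' : Continuous E') (heven : ∀ u, E (-u) = E u) (hd : LipschitzWith 1 d)
    (hdeven : ∀ u, d (-u) = d u) (hδ : 0 < δ) (hρ : 0 < ρ)
    (hbound : ∀ u, |E u - c| ≤ ρ → 3 * δ / 4 ≤ d u → ρ ≤ ‖E' u‖)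
    (hε : ε ∈ Ioo 0 (min ρ (δ * ρ / 16))) :
    ∃ η : X → ℝ → X, Continuous (fun q : X × ℝ => η q.1 q.2) ∧ (∀ u, η u 0 = u) ∧
      (∀ t, (∃ h : X ≃ₜ X, ∀ u, h u = η u t) ∧ ∀ u, η (-u) t = -η u t) ∧
      (∀ t u, (E u < c - 2 * ε ∨ c + 2 * ε < E u ∨ d u ≤ δ / 3) → η u t = u) ∧
      (∀ u, ∀ t ∈ Icc (0 : ℝ) 1, ‖η u t - u‖ ≤ δ / 4) ∧
      (∀ u, Antitone fun t => E (η u t)) ∧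
      (∀ u, E u ≤ c + ε → δ < d u → E (η u 1) ≤ c - ε) := by
  obtain ⟨hε0, hε⟩ := hε
  rw [lt_min_iff] at hε
  obtain ⟨V, hV, hVodd, hVnorm, hVle, hVdecr, hVzero⟩ :=
    exists_odd_pseudoGradient hE hE' heven hd.continuous hdeven hδ hρ ⟨hε0, hε.1.le⟩ hbound
  obtain ⟨φ, hφ0, hφ, hφadd, hφc⟩ := hV.exists_global_flow (C := ⟨δ / 4, by positivity⟩) hVnorm
  have hEφ : ∀ u t, HasDerivAt (fun s => E (φ u s)) (E' (φ u t) (V (φ u t))) t := fun u t =>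
    (hE (φ u t)).comp_hasDerivAt t (hφ u t)
  have hanti : ∀ u, Antitone fun t => E (φ u t) := fun u =>
    antitone_of_deriv_nonpos (fun t => (hEφ u t).differentiableAt)
      fun t => (hEφ u t).deriv ▸ hVle _
  have hmove : ∀ u, ∀ t ∈ Icc (0 : ℝ) 1, ‖φ u t - u‖ ≤ δ / 4 := fun u t ht => by
    have := norm_image_sub_le_of_norm_deriv_le_segment' (a := 0) (b := 1)
      (fun s _ => (hφ u s).hasDerivWithinAt) (fun s _ => hVnorm (φ u s)) t ht
    rw [hφ0, sub_zero] at this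
    exact this.trans (mul_le_of_le_one_right (by positivity) ht.2)
  refine ⟨φ, hφc, hφ0, fun t => ⟨⟨?_, fun u => ?_⟩, fun u => ?_⟩, fun t u hu => ?_, hmove, hanti,
    fun u hu hdu => ?_⟩
  · exact
      { toFun := fun u => φ u t
        invFun := fun u => φ u (-t)
        left_inv := fun u => (hφadd u t (-t)).trans (by rw [add_neg_cancel, hφ0])
        right_inv := fun u => (hφadd u (-t) t).trans (by rw [neg_add_cancel, hφ0])
        continuous_toFun := hφc.comp (by fun_prop : Continuous fun u : X => (u, t))
        continuous_invFun := hφc.comp (by fun_prop : Continuous fun u : X => (u, -t)) }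
  · rfl
  · refine congrFun (hV.eq_of_hasDerivAt (hφ (-u)) (g := fun s => -φ u s) (fun s => ?_) ?_) t
    · rw [hVodd]
      exact (hφ u s).neg
    · simp only [hφ0]
  · have hVu : V u = 0 := hVzero u <| by
      rcases hu with h | h | h
      · exact .inl (le_abs.2 (.inr (by linarith)))
      · exact .inl (le_abs.2 (.inl (by linarith)))
      · exact .inr h
    exact congrFun (hV.eq_of_hasDerivAt (hφ u) (g := fun _ => u)
      (fun s => hVu ▸ hasDerivAt_const s u) (hφ0 u)) t
  · by_contra! hlt
    have hdecr : ∀ t ∈ Ico (0 : ℝ) 1, E' (φ u t) (V (φ u t)) ≤ -(δ * ρ / 8) := fun t ht => by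
      have h1 : E (φ u 1) ≤ E (φ u t) := hanti u ht.2.le
      have h0 : E (φ u t) ≤ E (φ u 0) := hanti u ht.1
      rw [hφ0] at h0
      refine hVdecr _ (abs_le.2 ⟨by linarith, by linarith⟩) ?_
      have hdist := hd.dist_le_mul u (φ u t)
      rw [dist_comm u, dist_eq_norm (φ u t), Real.dist_eq, NNReal.coe_one, one_mul] at hdist
      linarith [hmove u t ⟨ht.1, ht.2.le⟩, le_abs_self (d u - d (φ u t))]
    have hfinal : E (φ u 1) ≤ E u + -(δ * ρ / 8) * 1 :=
      image_le_of_deriv_right_le_deriv_boundary (f := fun t => E (φ u t))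
        (B := fun t => E u + -(δ * ρ / 8) * t) (a := 0) (b := 1)
        (HasDerivAt.continuousOn fun t _ => hEφ u t) (fun t _ => (hEφ u t).hasDerivWithinAt)
        (by simp [hφ0]) (by fun_prop)
        (fun t _ => (((hasDerivAt_id t).const_mul _).const_add _).hasDerivWithinAt)
        (fun t ht => by simpa using hdecr t ht) (right_mem_Icc.2 zero_le_one)
    linarith

end Deformation

/-- Deformation lemma (Lemma 1 of the paper) under condition (C2). -/
theorem deformation_lemma
    {D : Type*} [NormedAddCommGroup D] [NormedSpace ℝ D] [CompleteSpace D]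
    (W : Submodule ℝ D) (hWclosed : IsClosed (W : Set D))
    (E : W → ℝ) (E' : W → (W →L[ℝ] ℝ))
    (hEderiv : ∀ u : W, HasFDerivAt E (E' u) u) (hE'cont : Continuous E')
    (hEeven : ∀ u : W, E (-u) = E u) (hE0 : E 0 = 0)
    (cstar : ℝ) (hcstar : 0 < cstar) (b : ℝ) (hb : cstar < b)
    (M : ℝ → Set D)
    (hM : ∀ c ∈ Ico cstar b, M c ⊆ {(0 : D)}ᶜ)
    -- condition (C2)(i)
    (hC2i : ∀ c ∈ Ico cstar b, ∀ u : ℕ → W,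
      Tendsto (fun n => E (u n)) atTop (𝓝 c) →
      Tendsto (fun n => ‖E' (u n)‖) atTop (𝓝 0) →
      (∃ (v : W) (φ : ℕ → ℕ), StrictMono φ ∧ E' v = 0 ∧ E v = c ∧
          Tendsto (fun n => u (φ n)) atTop (𝓝 v)) ∨
      (∃ (v : W) (φ : ℕ → ℕ), StrictMono φ ∧ E' v = 0 ∧ E v = c - cstar ∧
          (∀ g : W →L[ℝ] ℝ, Tendsto (fun n => g (u (φ n))) atTop (𝓝 (g v))) ∧
          (Tendsto (fun n => infDist (u (φ n) : D) (M c)) atTop (𝓝 0) ∨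
           Tendsto (fun n => infDist (u (φ n) : D) (-(M c))) atTop (𝓝 0))))
    -- condition (C2)(ii)
    (hC2ii : ∀ c ∈ Ico cstar b, ∃ δ₀ > (0:ℝ), ∀ δ ∈ Ioo (0:ℝ) δ₀,
      ¬ ∃ u : W, infDist (u : D) (M c) ≤ δ ∧ infDist (u : D) (-(M c)) ≤ δ)
    (c : ℝ) (hc : c ∈ Ico cstar b) (δ : ℝ) (hδ : 0 < δ) :
    ∃ ε₀ > (0:ℝ), ∀ ε ∈ Ioo (0:ℝ) ε₀, ∃ η : W → ℝ → W,
      -- η is continuous on W × [0,1]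
      ContinuousOn (fun q : W × ℝ => η q.1 q.2) (univ ×ˢ Icc 0 1) ∧
      -- (i) η(·,0) is the identity
      (∀ u : W, η u 0 = u) ∧
      -- (ii) η(·,t) is an odd homeomorphism of W for all t ∈ [0,1]
      (∀ t ∈ Icc (0:ℝ) 1, (∃ h : W ≃ₜ W, ∀ u : W, h u = η u t) ∧
        (∀ u : W, η (-u) t = -(η u t))) ∧
      -- (iii) η(·,t) is the identity outside E_{c-2ε}^{c+2ε} \ N_{δ/3}(B),
      --       where B = K_c ∪ M_c ∪ (−M_c)
      (∀ t ∈ Icc (0:ℝ) 1, ∀ u : W,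
        (E u < c - 2*ε ∨ c + 2*ε < E u ∨
          infDist (u : D)
            ((Subtype.val '' {w : W | E' w = 0 ∧ E w = c}) ∪ M c ∪ (-(M c))) ≤ δ/3) →
        η u t = u) ∧
      -- (iv) ‖η(u,t) − u‖ ≤ δ/4
      (∀ u : W, ∀ t ∈ Icc (0:ℝ) 1, ‖η u t - u‖ ≤ δ/4) ∧
      -- (v) t ↦ E(η(u,t)) is nonincreasing on [0,1]
      (∀ u : W, AntitoneOn (fun t => E (η u t)) (Icc 0 1)) ∧
      -- (vi) η(E^{c+ε} \ N_δ(B), 1) ⊂ E^{c−ε}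
      (∀ u : W, E u ≤ c + ε →
        δ < infDist (u : D)
          ((Subtype.val '' {w : W | E' w = 0 ∧ E w = c}) ∪ M c ∪ (-(M c))) →
        E (η u 1) ≤ c - ε) := by
  have : CompleteSpace W := hWclosed.completeSpace_coe
  have hE'neg := fderiv_neg_eq_neg_of_even hEderiv hEeven
  set B : Set D := (Subtype.val '' {w : W | E' w = 0 ∧ E w = c}) ∪ M c ∪ (-(M c)) with hB
  have hMne : (M c).Nonempty := by
    by_contra h
    obtain ⟨δ₀, hδ₀, hM₀⟩ := hC2ii c hc
    rw [not_nonempty_iff_eq_empty] at h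
    refine hM₀ (δ₀ / 2) ⟨by positivity, by linarith⟩ ⟨0, ?_⟩
    simp only [h, neg_empty, infDist_empty]
    exact ⟨by positivity, by positivity⟩
  have hBneg : -B = B := by
    have hK : -(Subtype.val '' {w : W | E' w = 0 ∧ E w = c} : Set D) =
        Subtype.val '' {w : W | E' w = 0 ∧ E w = c} := by
      ext x
      simp only [Set.mem_neg, mem_image, mem_ofPred_eq]
      constructor <;> rintro ⟨w, ⟨h1, h2⟩, h3⟩ <;>
        exact ⟨-w, ⟨by rw [hE'neg, h1, neg_zero], by rw [hEeven, h2]⟩, by simp [h3]⟩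
    rw [hB, union_neg, union_neg, neg_neg, hK, union_right_comm]
  have hd : LipschitzWith 1 (fun u : W => infDist (u : D) B) := by
    simpa [Function.comp_def] using (lipschitz_infDist_pt B).comp W.subtypeₗᵢ.lipschitz
  have hdneg : ∀ u : W, infDist ((-u : W) : D) B = infDist (u : D) B := fun u => by
    conv_lhs => rw [← hBneg, ← image_neg_eq_neg]
    exact infDist_image (isometry_neg (G := D))
  obtain ⟨ρ, hρ, hbound⟩ : ∃ ρ > (0 : ℝ), ∀ u : W, |E u - c| ≤ ρ →
      3 * δ / 4 ≤ infDist (u : D) B → ρ ≤ ‖E' u‖ := by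
    by_contra! h
    choose u hu1 hu2 hu3 using fun n : ℕ => h (1 / ((n : ℝ) + 1)) (by positivity)
    have hlim := tendsto_one_div_add_atTop_nhds_zero_nat (𝕜 := ℝ)
    have hfar : ∀ φ : ℕ → ℕ, ¬ Tendsto (fun n => infDist (u (φ n) : D) B) atTop (𝓝 0) :=
      fun φ hφ => by linarith [ge_of_tendsto' hφ fun n => hu2 (φ n)]
    have hnear : ∀ (φ : ℕ → ℕ) (A : Set D), A ⊆ B → A.Nonempty →
        ¬ Tendsto (fun n => infDist (u (φ n) : D) A) atTop (𝓝 0) := fun φ A hA hne hφ =>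
      hfar φ (squeeze_zero (fun _ => infDist_nonneg)
        (fun _ => infDist_le_infDist_of_subset hA hne) hφ)
    rcases hC2i c hc u (tendsto_iff_dist_tendsto_zero.2 (squeeze_zero (fun _ => dist_nonneg) hu1
      hlim)) (squeeze_zero (fun n => norm_nonneg (E' (u n))) (fun n => (hu3 n).le) hlim) with
      ⟨v, φ, -, hv, hvc, hφ⟩ | ⟨v, φ, -, -, -, -, hφ | hφ⟩
    · refine hfar φ ?_
      have hvB : (v : D) ∈ B := .inl (.inl ⟨v, ⟨hv, hvc⟩, rfl⟩)
      simpa [Function.comp_def, infDist_zero_of_mem hvB] using (hd.continuous.tendsto v).comp hφ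
    · exact hnear φ (M c) (fun x hx => .inl (.inr hx)) hMne hφ
    · exact hnear φ (-(M c)) (fun x hx => .inr hx) hMne.neg hφ
  refine ⟨min ρ (δ * ρ / 16), by positivity, fun ε hε => ?_⟩
  obtain ⟨η, hηc, hη0, hηh, hηfix, hηmove, hηanti, hηdecr⟩ :=
    exists_deformation_of_norm_fderiv_ge hEderiv hE'cont hEeven hd hdneg hδ hρ hbound hε
  exact ⟨η, hηc.continuousOn, hη0, fun t _ => hηh t, fun t _ => hηfix t, hηmove,
    fun u => (hηanti u).antitoneOn _, hηdecr⟩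
end

section
/- Assume condition (C2) holds (for some constants c* > 0 and b > c* and sets M_c as in (C2)). Let c ∈ [c*, b), set B = K_c ∪ M_c ∪ (−M_c), and let δ > 0. Then there exists ε₀ > 0 such that for every ε ∈ (0, ε₀) and every u ∈ W with c − 2ε ≤ E(u) ≤ c + 2ε and dist(u, B) > δ/3, one has ‖E'(u)‖_{W*} ≥ 32ε/δ. -/
open Metric Set Filter Topology

/-- Inequality (2) in the proof of Lemma 1: a lower bound on ‖E'(u)‖ away from
B = K_c ∪ M_c ∪ (−M_c), under condition (C2). -/
theorem quantitative_deformation_bound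
    {D : Type*} [NormedAddCommGroup D] [NormedSpace ℝ D] [CompleteSpace D]
    (W : Submodule ℝ D) (hWclosed : IsClosed (W : Set D))
    (E : W → ℝ) (E' : W → (W →L[ℝ] ℝ))
    (hEderiv : ∀ u : W, HasFDerivAt E (E' u) u) (hE'cont : Continuous E')
    (hEeven : ∀ u : W, E (-u) = E u) (hE0 : E 0 = 0)
    (cstar : ℝ) (hcstar : 0 < cstar) (b : ℝ) (hb : cstar < b)
    (M : ℝ → Set D)
    (hM : ∀ c ∈ Ico cstar b, M c ⊆ {(0 : D)}ᶜ)
    -- condition (C2)(i)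
    (hC2i : ∀ c ∈ Ico cstar b, ∀ u : ℕ → W,
      Tendsto (fun n => E (u n)) atTop (𝓝 c) →
      Tendsto (fun n => ‖E' (u n)‖) atTop (𝓝 0) →
      (∃ (v : W) (φ : ℕ → ℕ), StrictMono φ ∧ E' v = 0 ∧ E v = c ∧
          Tendsto (fun n => u (φ n)) atTop (𝓝 v)) ∨
      (∃ (v : W) (φ : ℕ → ℕ), StrictMono φ ∧ E' v = 0 ∧ E v = c - cstar ∧
          (∀ g : W →L[ℝ] ℝ, Tendsto (fun n => g (u (φ n))) atTop (𝓝 (g v))) ∧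
          (Tendsto (fun n => infDist (u (φ n) : D) (M c)) atTop (𝓝 0) ∨
           Tendsto (fun n => infDist (u (φ n) : D) (-(M c))) atTop (𝓝 0))))
    -- condition (C2)(ii)
    (hC2ii : ∀ c ∈ Ico cstar b, ∃ δ₀ > (0:ℝ), ∀ δ ∈ Ioo (0:ℝ) δ₀,
      ¬ ∃ u : W, infDist (u : D) (M c) ≤ δ ∧ infDist (u : D) (-(M c)) ≤ δ)
    (c : ℝ) (hc : c ∈ Ico cstar b) (δ : ℝ) (hδ : 0 < δ) :
    ∃ ε₀ > (0:ℝ), ∀ ε ∈ Ioo (0:ℝ) ε₀, ∀ u : W,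
      c - 2*ε ≤ E u → E u ≤ c + 2*ε →
      δ/3 < infDist (u : D)
        ((Subtype.val '' {w : W | E' w = 0 ∧ E w = c}) ∪ M c ∪ (-(M c))) →
      32*ε/δ ≤ ‖E' u‖ := by
  obtain ⟨δ₀, hδ₀, hsep⟩ := hC2ii c hc
  have hne : (M c).Nonempty := by
    by_contra h
    rw [not_nonempty_iff_eq_empty] at h
    refine hsep (δ₀ / 2) ⟨by linarith, by linarith⟩ ⟨0, ?_, ?_⟩ <;>
      simp [h, infDist_empty] <;> linarith
  by_contra! hcon
  choose ε hε u hlo hhi hdist hnorm using fun n : ℕ =>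
    hcon (1 / ((n : ℝ) + 1)) Nat.one_div_pos_of_nat
  have hε0 : Tendsto ε atTop (𝓝 0) :=
    squeeze_zero (fun n => (hε n).1.le) (fun n => (hε n).2.le)
      tendsto_one_div_add_atTop_nhds_zero_nat
  have hE : Tendsto (fun n => E (u n)) atTop (𝓝 c) := by
    refine tendsto_of_tendsto_of_tendsto_of_le_of_le ?_ ?_ hlo hhi
    · simpa using (hε0.const_mul 2).const_sub c
    · simpa using (hε0.const_mul 2).const_add c
  have hE' : Tendsto (fun n => ‖E' (u n)‖) atTop (𝓝 0) := by
    refine squeeze_zero (fun n => norm_nonneg (E' (u n))) (fun n => (hnorm n).le) ?_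
    simpa using (hε0.const_mul 32).div_const δ
  -- A subsequence of `u` cannot approach a nonempty subset of `K_c ∪ M_c ∪ (−M_c)`.
  have hfar : ∀ (S : Set D) (φ : ℕ → ℕ), S.Nonempty →
      S ⊆ (Subtype.val '' {w : W | E' w = 0 ∧ E w = c}) ∪ M c ∪ (-(M c)) →
      ¬ Tendsto (fun n => infDist (u (φ n) : D) S) atTop (𝓝 0) := by
    intro S φ hS hSB hlim
    have hle : δ / 3 ≤ 0 := ge_of_tendsto' hlim fun n =>
      (hdist (φ n)).le.trans (infDist_le_infDist_of_subset hSB hS)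
    linarith
  rcases hC2i c hc u hE hE' with
    ⟨v, φ, -, hv0, hvc, hlim⟩ | ⟨v, φ, -, -, -, -, hlim | hlim⟩
  · refine hfar {(v : D)} φ (singleton_nonempty _) ?_ ?_
    · rintro _ rfl
      exact Or.inl (Or.inl ⟨v, ⟨hv0, hvc⟩, rfl⟩)
    · simp only [infDist_singleton]
      exact tendsto_iff_dist_tendsto_zero.mp ((continuous_subtype_val.tendsto v).comp hlim)
  · exact hfar (M c) φ hne (fun x hx => Or.inl (Or.inr hx)) hlim
  · exact hfar (-(M c)) φ hne.neg (fun x hx => Or.inr hx) hlim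
end

section
/- Assume (A1), (A2), (B1), (B2), and the potential identities I_p(u) = ‖u‖^p/p and J_p(u) = ⟨B_p u, u⟩/p, together with (F1): F(u) = o(‖u‖^p) as u → 0, i.e., for every ε > 0 there exists ρ > 0 such that |F(u)| ≤ ε‖u‖^p whenever ‖u‖ ≤ ρ. Let λ ∈ ℝ and μ > max(λ, 0), and let B₀ be a subset of the unit sphere S of W such that Ψ(u) ≥ μ for all u ∈ B₀ (equivalently, ⟨B_p u, u⟩ ≤ 1/μ for all u ∈ B₀). Then there exists r₀ > 0 such that for every r ∈ (0, r₀], inf{E(ru) : u ∈ B₀} > 0. -/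
open Set

/-- Under (A1), (A2), (B1), (B2), the potential identities and (F1), if
λ⁺ < μ and Ψ ≥ μ on B₀ ⊂ S (i.e. ⟨B_p u, u⟩ ≤ 1/μ on B₀), then
inf {E(ru) : u ∈ B₀} > 0 for all sufficiently small r > 0. -/
theorem inf_positive_on_small_sphere
    {W : Type*} [NormedAddCommGroup W] [NormedSpace ℝ W] [CompleteSpace W]
    (p : ℝ) (hp : 1 < p)
    (Ap Bp f : W → (W →L[ℝ] ℝ))
    (hApcont : Continuous Ap) (hBpcont : Continuous Bp) (hfcont : Continuous f)
    (Ip Jp F : W → ℝ)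
    (hIp : ∀ u : W, HasFDerivAt Ip (Ap u) u)
    (hJp : ∀ u : W, HasFDerivAt Jp (Bp u) u)
    (hF : ∀ u : W, HasFDerivAt F (f u) u)
    (hIp0 : Ip 0 = 0) (hJp0 : Jp 0 = 0) (hF0 : F 0 = 0)
    -- (A1)
    (hA1 : ∀ (u : W) (t : ℝ), Ap (t • u) = (|t| ^ (p - 2) * t) • Ap u)
    -- (A2)
    (hA2 : ∀ u v : W, Ap u v ≤ ‖u‖ ^ (p - 1) * ‖v‖)
    (hA2' : ∀ u : W, Ap u u = ‖u‖ ^ p)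
    -- (B1)
    (hB1 : ∀ (u : W) (t : ℝ), Bp (t • u) = (|t| ^ (p - 2) * t) • Bp u)
    -- (B2)
    (hB2 : ∀ u : W, u ≠ 0 → 0 < Bp u u)
    -- potential identities
    (hIpval : ∀ u : W, Ip u = ‖u‖ ^ p / p)
    (hJpval : ∀ u : W, Jp u = Bp u u / p)
    -- (F1): F(u) = o(‖u‖^p) as u → 0
    (hF1 : ∀ ε > (0:ℝ), ∃ ρ > (0:ℝ), ∀ u : W, ‖u‖ ≤ ρ → |F u| ≤ ε * ‖u‖ ^ p)
    (lam μ : ℝ) (hμ : max lam 0 < μ)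
    (B₀ : Set W) (hB₀S : ∀ u ∈ B₀, ‖u‖ = 1)
    (hB₀Ψ : ∀ u ∈ B₀, Bp u u ≤ 1 / μ)
    (E : W → ℝ) (hE : ∀ u : W, E u = Ip u - lam * Jp u - F u) :
    ∃ r₀ > (0:ℝ), ∀ r ∈ Ioc (0:ℝ) r₀, ∃ m > (0:ℝ), ∀ u ∈ B₀, m ≤ E (r • u) := by
  have hμ0 : 0 < μ := (le_max_right _ _).trans_lt hμ
  have hp0 : 0 < p := by linarith
  set c : ℝ := 1 - max lam 0 / μ with hc
  have hcpos : 0 < c := by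
    have : max lam 0 / μ < 1 := (div_lt_one hμ0).2 hμ
    linarith
  have hε : 0 < c / p / 2 := by positivity
  obtain ⟨ρ, hρ, hFρ⟩ := hF1 (c / p / 2) hε
  refine ⟨ρ, hρ, fun r hr => ⟨c / p / 2 * r ^ p, ?_, fun u hu => ?_⟩⟩
  · exact mul_pos hε (Real.rpow_pos_of_pos hr.1 p)
  have hr0 : 0 < r := hr.1
  have hnorm : ‖r • u‖ = r := by
    rw [norm_smul, hB₀S u hu, Real.norm_of_nonneg hr0.le, mul_one]
  have hrp : 0 < r ^ p := Real.rpow_pos_of_pos hr0 p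
  have hFu := hFρ (r • u) (hnorm.le.trans hr.2)
  rw [hnorm] at hFu
  have hu0 : u ≠ 0 := by
    rintro rfl
    simpa using hB₀S 0 hu
  have hB : Bp (r • u) (r • u) = r ^ p * Bp u u := by
    have hpow : r ^ p = r ^ (p - 2) * r * r := by
      rw [mul_assoc, ← sq, ← Real.rpow_two, ← Real.rpow_add hr0, sub_add_cancel]
    rw [hB1, hpow, abs_of_pos hr0]
    simp only [smul_apply, map_smul, smul_eq_mul]
    ring
  have hlam : lam * Bp u u ≤ 1 - c := by
    calc lam * Bp u u ≤ max lam 0 * Bp u u :=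
          mul_le_mul_of_nonneg_right (le_max_left _ _) (hB2 u hu0).le
      _ ≤ max lam 0 * (1 / μ) :=
          mul_le_mul_of_nonneg_left (hB₀Ψ u hu) (le_max_right _ _)
      _ = 1 - c := by rw [hc]; ring
  have hmain : c / p * r ^ p ≤ Ip (r • u) - lam * Jp (r • u) := by
    have hrw : Ip (r • u) - lam * Jp (r • u) = (1 - lam * Bp u u) / p * r ^ p := by
      rw [hIpval, hJpval, hB, hnorm]
      ring
    rw [hrw]
    gcongr
    linarith
  rw [hE]
  linarith [le_abs_self (F (r • u))]
end
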